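/- Let d ≥ 2, let c₁, c₂ be unit vectors in the Euclidean space ℝ^d, and let τ₁, τ₂ ∈ (-1, 1). Define the open spherical caps C_i = { x ∈ ℝ^d : ‖x‖ = 1 and ⟨x, c_i⟩ > τ_i } for i = 1, 2. Then C₁ ∩ C₂ is nonempty if and only if arccos⟨c₁, c₂⟩ < arccos τ₁ + arccos τ₂. In particular, co-firing of two embedding signals under independent thresholding is decidable from the centroid embeddings and thresholds alone. -/

import Mathlib

open scoped InnerProductSpace

section

variable {V : Type*} [NormedAddCommGroup V] [InnerProductSpace ℝ V]

/-- In dimension at least two, every vector has a unit vector orthogonal to it. -/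
lemma exists_norm_eq_one_inner_eq_zero (hV : 2 ≤ Module.finrank ℝ V) (c : V) :
    ∃ u : V, ‖u‖ = 1 ∧ ⟪c, u⟫_ℝ = 0 := by
  have hne : (ℝ ∙ c)ᗮ ≠ ⊥ := by
    intro h
    have htop : (ℝ ∙ c) = ⊤ := Submodule.orthogonal_eq_bot_iff.mp h
    have hle : Module.finrank ℝ (ℝ ∙ c) ≤ 1 := by
      simpa using finrank_span_le_card (R := ℝ) ({c} : Set V)
    rw [htop, finrank_top] at hle
    omega
  obtain ⟨v, hv, hv0⟩ := Submodule.exists_mem_ne_zero_of_ne_bot hne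
  refine ⟨(‖v‖⁻¹ : ℝ) • v, norm_smul_inv_norm (𝕜 := ℝ) hv0, ?_⟩
  rw [inner_smul_right, Submodule.mem_orthogonal_singleton_iff_inner_right.mp hv, mul_zero]

/-- Polar decomposition of a unit vector with respect to another one. -/
lemma exists_eq_cos_smul_add_sin_smul (hV : 2 ≤ Module.finrank ℝ V) {c₁ c₂ : V}
    (hc₁ : ‖c₁‖ = 1) (hc₂ : ‖c₂‖ = 1) :
    ∃ u : V, ‖u‖ = 1 ∧ ⟪c₁, u⟫_ℝ = 0 ∧
      c₂ = Real.cos (Real.arccos ⟪c₁, c₂⟫_ℝ) • c₁ +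
        Real.sin (Real.arccos ⟪c₁, c₂⟫_ℝ) • u := by
  have habs : |⟪c₁, c₂⟫_ℝ| ≤ 1 := by
    simpa [hc₁, hc₂] using abs_real_inner_le_norm c₁ c₂
  rw [Real.cos_arccos (abs_le.mp habs).1 (abs_le.mp habs).2, Real.sin_arccos]
  set w : V := c₂ - ⟪c₁, c₂⟫_ℝ • c₁ with hw
  have hc₁w : ⟪c₁, w⟫_ℝ = 0 := by
    simp [hw, inner_sub_right, inner_smul_right, hc₁]
  have hnorm : √(1 - ⟪c₁, c₂⟫_ℝ ^ 2) = ‖w‖ := by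
    have hsq : ‖w‖ ^ 2 = 1 - ⟪c₁, c₂⟫_ℝ ^ 2 := by
      rw [hw, norm_sub_sq_real, inner_smul_right, norm_smul, hc₁, hc₂, real_inner_comm c₁ c₂,
        Real.norm_eq_abs, mul_one, sq_abs]
      ring
    rw [← hsq, Real.sqrt_sq (norm_nonneg w)]
  rw [hnorm]
  by_cases hw0 : w = 0
  · obtain ⟨u, hu, hc₁u⟩ := exists_norm_eq_one_inner_eq_zero hV c₁
    refine ⟨u, hu, hc₁u, ?_⟩
    rw [hw0, norm_zero, zero_smul, add_zero]
    exact sub_eq_zero.mp hw0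
  · refine ⟨(‖w‖⁻¹ : ℝ) • w, norm_smul_inv_norm (𝕜 := ℝ) hw0, ?_, ?_⟩
    · rw [inner_smul_right, hc₁w, mul_zero]
    · rw [smul_smul, mul_inv_cancel₀ (norm_ne_zero_iff.mpr hw0), one_smul, hw]
      abel

/-- The great circle through two unit vectors, parametrised by arc length from the first. -/
lemma exists_norm_eq_one_inner_eq_cos (hV : 2 ≤ Module.finrank ℝ V) {c₁ c₂ : V}
    (hc₁ : ‖c₁‖ = 1) (hc₂ : ‖c₂‖ = 1) (s : ℝ) :
    ∃ x : V, ‖x‖ = 1 ∧ ⟪x, c₁⟫_ℝ = Real.cos s ∧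
      ⟪x, c₂⟫_ℝ = Real.cos (Real.arccos ⟪c₁, c₂⟫_ℝ - s) := by
  obtain ⟨u, hu, hc₁u, hc₂u⟩ := exists_eq_cos_smul_add_sin_smul hV hc₁ hc₂
  have huc₁ : ⟪u, c₁⟫_ℝ = 0 := by rw [real_inner_comm, hc₁u]
  generalize Real.arccos ⟪c₁, c₂⟫_ℝ = θ at hc₂u ⊢
  refine ⟨Real.cos s • c₁ + Real.sin s • u, ?_, ?_, ?_⟩
  · have hsq : ‖Real.cos s • c₁ + Real.sin s • u‖ ^ 2 = 1 := by
      rw [norm_add_sq_real, inner_smul_left, inner_smul_right, hc₁u, norm_smul, norm_smul, hc₁, hu]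
      simp
    exact (pow_eq_one_iff_of_nonneg (norm_nonneg _) two_ne_zero).mp hsq
  · simp [inner_add_left, inner_smul_left, hc₁, huc₁]
  · rw [hc₂u, Real.cos_sub]
    simp [inner_add_left, inner_add_right, inner_smul_left, inner_smul_right, hc₁, hu, hc₁u, huc₁]

/-- For unit vectors, an inner product above `τ` means an angle below `arccos τ`. -/
lemma angle_lt_arccos_of_lt_inner {x c : V} (hx : ‖x‖ = 1) (hc : ‖c‖ = 1) {τ : ℝ}
    (hτ : -1 ≤ τ) (h : τ < ⟪x, c⟫_ℝ) :
    InnerProductGeometry.angle x c < Real.arccos τ := by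
  have hle : ⟪x, c⟫_ℝ ≤ 1 := by simpa [hx, hc] using real_inner_le_norm x c
  rw [InnerProductGeometry.angle, hx, hc, mul_one, div_one]
  exact Real.arccos_lt_arccos hτ h hle

end

/-- An angle in `[0, arccos τ)` has cosine above `τ`. -/
lemma lt_cos_of_lt_arccos {τ s : ℝ} (hτ : τ ∈ Set.Icc (-1 : ℝ) 1) (hs : 0 ≤ s)
    (h : s < Real.arccos τ) : τ < Real.cos s := by
  have hcos := Real.cos_lt_cos_of_nonneg_of_le_pi hs (Real.arccos_le_pi τ) h
  rwa [Real.cos_arccos hτ.1 hτ.2] at hcos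

/-- Spherical-cap intersection criterion (case 2 of Theorem 1): the open caps
with centroids `c₁, c₂` and cosine thresholds `τ₁, τ₂` intersect iff the
angular separation of the centroids is less than the sum of the angular
radii. -/
theorem spherical_caps_intersect_iff
    (d : ℕ) (hd : 2 ≤ d)
    (c₁ c₂ : EuclideanSpace ℝ (Fin d)) (hc₁ : ‖c₁‖ = 1) (hc₂ : ‖c₂‖ = 1)
    (τ₁ τ₂ : ℝ) (hτ₁ : τ₁ ∈ Set.Ioo (-1 : ℝ) 1) (hτ₂ : τ₂ ∈ Set.Ioo (-1 : ℝ) 1) :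
    ({x : EuclideanSpace ℝ (Fin d) | ‖x‖ = 1 ∧ τ₁ < ⟪x, c₁⟫_ℝ} ∩
      {x : EuclideanSpace ℝ (Fin d) | ‖x‖ = 1 ∧ τ₂ < ⟪x, c₂⟫_ℝ}).Nonempty ↔
      Real.arccos ⟪c₁, c₂⟫_ℝ < Real.arccos τ₁ + Real.arccos τ₂ := by
  constructor
  · rintro ⟨x, ⟨hx, h₁⟩, -, h₂⟩
    have htri := InnerProductGeometry.angle_le_angle_add_angle c₁ x c₂
    rw [InnerProductGeometry.angle_comm c₁ x] at htri
    have hangle : InnerProductGeometry.angle c₁ c₂ = Real.arccos ⟪c₁, c₂⟫_ℝ := by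
      rw [InnerProductGeometry.angle, hc₁, hc₂, mul_one, div_one]
    have h₁' := angle_lt_arccos_of_lt_inner hx hc₁ hτ₁.1.le h₁
    have h₂' := angle_lt_arccos_of_lt_inner hx hc₂ hτ₂.1.le h₂
    linarith
  · intro h
    have hα : 0 < Real.arccos τ₁ := Real.arccos_pos.mpr hτ₁.2
    have hβ : 0 < Real.arccos τ₂ := Real.arccos_pos.mpr hτ₂.2
    have hθ : 0 ≤ Real.arccos ⟪c₁, c₂⟫_ℝ := Real.arccos_nonneg _
    obtain ⟨s, hs₀, hsθ, hs₁, hs₂⟩ : ∃ s, 0 ≤ s ∧ s ≤ Real.arccos ⟪c₁, c₂⟫_ℝ ∧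
        s < Real.arccos τ₁ ∧ Real.arccos ⟪c₁, c₂⟫_ℝ - s < Real.arccos τ₂ := by
      rcases lt_or_ge (Real.arccos ⟪c₁, c₂⟫_ℝ) (Real.arccos τ₂) with hlt | hge
      · exact ⟨0, le_rfl, hθ, hα, by linarith⟩
      · refine ⟨(Real.arccos ⟪c₁, c₂⟫_ℝ - Real.arccos τ₂ +
          min (Real.arccos ⟪c₁, c₂⟫_ℝ) (Real.arccos τ₁)) / 2, ?_, ?_, ?_, ?_⟩ <;>
        rcases min_cases (Real.arccos ⟪c₁, c₂⟫_ℝ) (Real.arccos τ₁) with ⟨hm, _⟩ | ⟨hm, _⟩ <;>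
        rw [hm] <;> linarith
    obtain ⟨x, hx, hx₁, hx₂⟩ :=
      exists_norm_eq_one_inner_eq_cos (by simpa using hd) hc₁ hc₂ s
    refine ⟨x, ⟨hx, ?_⟩, hx, ?_⟩
    · rw [hx₁]
      exact lt_cos_of_lt_arccos (Set.Ioo_subset_Icc_self hτ₁) hs₀ hs₁
    · rw [hx₂]
      exact lt_cos_of_lt_arccos (Set.Ioo_subset_Icc_self hτ₂) (by linarith) hs₂
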